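/- Saturation-gap contraction inequality for one coordinate descent update of a sparse GLM: let γ > 0, for i ∈ [n] let f_i : ℝ → ℝ be differentiable, and write ∇F(u) = (f_1'(u_1), …, f_n'(u_n)) for u ∈ ℝ^n. Let X ∈ ℝ^{n×p} have columns x_1,…,x_p with x_j ≠ 0, let λ > 0 and let β̂ ∈ ℝ^p and j ∈ [p] satisfy β̂_j = 0 and |x_jᵀ∇F(Xβ̂)| < λ. Define h_j(β) = β_j − (γ/‖x_j‖²) x_jᵀ∇F(Xβ) and δ = (γλ/‖x_j‖²)(1 − |x_jᵀ∇F(Xβ̂)|/λ) > 0. Then for any β ∈ ℝ^p, if the coordinate update β⁺_j = ST(h_j(β), γλ/‖x_j‖²) is nonzero, one has |β⁺_j − β̂_j| ≤ |h_j(β) − h_j(β̂)| − δ. -/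

import Mathlib

open Finset Matrix

/-- Soft-thresholding of `x` at level `ν`: `ST(x, ν) = sign(x)·max(0, |x| − ν)`. -/
noncomputable def softThresh (x ν : ℝ) : ℝ := Real.sign x * max 0 (|x| - ν)

theorem abs_softThresh_of_ne_zero {x ν : ℝ} (h : softThresh x ν ≠ 0) :
    |softThresh x ν| = |x| - ν := by
  unfold softThresh at h ⊢
  have hmax : 0 < |x| - ν := by
    by_contra! hle
    exact h (by rw [max_eq_left hle, mul_zero])
  have hsign : |Real.sign x| = 1 := by
    rcases Real.sign_apply_eq x with hx | hx | hx
    · simp [hx]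
    · exact absurd (by rw [hx, zero_mul]) h
    · simp [hx]
  rw [max_eq_right hmax.le, abs_mul, hsign, one_mul, abs_of_pos hmax]

/-- Saturation-gap contraction inequality for one coordinate descent update of a
sparse GLM: if `β̂_j = 0` and `|x_jᵀ∇F(Xβ̂)| < λ`, then the saturation gap
`δ = (γλ/‖x_j‖²)(1 − |x_jᵀ∇F(Xβ̂)|/λ)` is positive, and for any `β`, if the
coordinate update `β⁺_j = ST(h_j(β), γλ/‖x_j‖²)` (with
`h_j(β) = β_j − (γ/‖x_j‖²) x_jᵀ∇F(Xβ)`) is nonzero, then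
`|β⁺_j − β̂_j| ≤ |h_j(β) − h_j(β̂)| − δ`. -/
theorem saturation_gap_contraction (n p : ℕ) (γ : ℝ) (hγ : 0 < γ)
    (f : Fin n → ℝ → ℝ) (hf : ∀ i, Differentiable ℝ (f i))
    (X : Matrix (Fin n) (Fin p) ℝ) (lam : ℝ) (hlam : 0 < lam)
    (j : Fin p) (hxj : (fun i => X i j) ≠ 0)
    (betah : Fin p → ℝ) (hbj : betah j = 0)
    (hnd : |∑ i, X i j * deriv (f i) (X.mulVec betah i)| < lam) :
    0 < (γ * lam / ∑ i, (X i j) ^ 2) *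
        (1 - |∑ i, X i j * deriv (f i) (X.mulVec betah i)| / lam) ∧
    ∀ beta : Fin p → ℝ,
      softThresh
          (beta j - (γ / ∑ i, (X i j) ^ 2) * ∑ i, X i j * deriv (f i) (X.mulVec beta i))
          (γ * lam / ∑ i, (X i j) ^ 2) ≠ 0 →
      |softThresh
          (beta j - (γ / ∑ i, (X i j) ^ 2) * ∑ i, X i j * deriv (f i) (X.mulVec beta i))
          (γ * lam / ∑ i, (X i j) ^ 2) - betah j| ≤
        |(beta j - (γ / ∑ i, (X i j) ^ 2) * ∑ i, X i j * deriv (f i) (X.mulVec beta i)) -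
          (betah j - (γ / ∑ i, (X i j) ^ 2) * ∑ i, X i j * deriv (f i) (X.mulVec betah i))| -
        (γ * lam / ∑ i, (X i j) ^ 2) *
          (1 - |∑ i, X i j * deriv (f i) (X.mulVec betah i)| / lam) := by
  have hs : 0 < ∑ i, (X i j) ^ 2 := by
    obtain ⟨i, hi⟩ := Function.ne_iff.mp hxj
    exact Finset.sum_pos' (fun k _ => sq_nonneg _) ⟨i, Finset.mem_univ i, sq_pos_of_ne_zero hi⟩
  generalize ∑ i, (X i j) ^ 2 = s at hs ⊢
  generalize ∑ i, X i j * deriv (f i) (X.mulVec betah i) = g at hnd ⊢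
  refine ⟨mul_pos (by positivity) (sub_pos.mpr ((div_lt_one hlam).mpr hnd)), ?_⟩
  intro beta hne
  rw [hbj, sub_zero, abs_softThresh_of_ne_zero hne]
  generalize beta j - (γ / s) * ∑ i, X i j * deriv (f i) (X.mulVec beta i) = h
  have hgap : γ * lam / s * (1 - |g| / lam) = γ * lam / s - |0 - γ / s * g| := by
    rw [zero_sub, abs_neg, abs_mul, abs_of_pos (div_pos hγ hs)]
    field_simp
  rw [hgap]
  linarith [abs_sub_abs_le_abs_sub h (0 - γ / s * g)]
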